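/- Let A be a finite-dimensional algebra over a field F with char(F) ≠ 2 and char(F) ≠ 3. If a linear map T : A → A satisfies T(x)³ − x³ ∈ [A,A] for every x ∈ A, then T(x⁴) − T(x)⁴ ∈ rad(A) for every x ∈ A. -/

import Mathlib

/-- The radical of a finite-dimensional algebra, realized as the intersection of all
maximal two-sided ideals. -/
noncomputable def ringRad (A : Type*) [Ring A] : TwoSidedIdeal A :=
  sInf {M : TwoSidedIdeal A | IsCoatom M}

section MatrixPreserver

open Matrix

variable {K n : Type*} [Field K] [Fintype n] [DecidableEq n]

/-- A linear functional on matrices vanishing on square-zero matrices is a multiple of the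
trace. -/
theorem exists_eq_mul_trace_of_sq_zero [Nonempty n] (f : Matrix n n K →ₗ[K] K)
    (hf : ∀ x, x * x = 0 → f x = 0) : ∃ κ, ∀ x, f x = κ * trace x := by
  have hoff : ∀ i j, i ≠ j → f (single i j 1) = 0 := fun i j hij =>
    hf _ (by rw [single_mul_single_of_ne _ _ _ _ hij.symm])
  have hdiag : ∀ i j, f (single i i 1) = f (single j j 1) := by
    intro i j
    rcases eq_or_ne i j with rfl | hij
    · rfl
    have h := hf (single i i 1 + single i j 1 - single j i 1 - single j j 1) (by
      simp [sub_mul, mul_sub, add_mul, mul_add, hij, hij.symm])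
    simp only [map_sub, map_add, hoff i j hij, hoff j i hij.symm] at h
    linear_combination h
  obtain ⟨k⟩ := ‹Nonempty n›
  refine ⟨f (single k k 1), fun x => ?_⟩
  conv_lhs => rw [matrix_eq_sum_single x]
  simp only [map_sum]
  rw [trace, Finset.mul_sum]
  refine Finset.sum_congr rfl fun i _ => ?_
  rw [Finset.sum_eq_single i]
  · have : single i i (x i i) = x i i • single i i (1 : K) := by simp
    rw [this, map_smul, hdiag i k, smul_eq_mul, diag_apply, mul_comm]
  · intro j _ hj
    have : single i j (x i j) = x i j • single i j (1 : K) := by simp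
    rw [this, map_smul, hoff i j hj.symm, smul_zero]
  · simp

/-- An idempotent matrix `p ≠ 0` with one-dimensional corner `p X p = K p` has trace one. -/
theorem trace_eq_one_of_corner {p : Matrix n n K} (hp : p * p = p)
    (h0 : p ≠ 0) (hc : ∀ x : Matrix n n K, ∃ l : K, p * x * p = l • p) : trace p = 1 := by
  choose l hl using hc
  have hent : ∀ i j a b, p a i * p j b = l (single i j 1) * p a b := by
    intro i j a b
    have := congrFun (congrFun (hl (single i j 1)) a) b
    rw [Matrix.smul_apply, smul_eq_mul] at this
    rw [← this, mul_assoc, mul_apply, Finset.sum_eq_single i]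
    · simp
    · intro k _ hk
      simp [hk]
    · simp
  have htr : ∀ i j, p j i = l (single i j 1) * trace p := by
    intro i j
    conv_lhs => rw [← hp]
    rw [mul_apply, trace, Finset.mul_sum]
    exact Finset.sum_congr rfl fun a _ => by rw [diag_apply, ← hent i j a a, mul_comm]
  have hkey : ∀ i j a b, p a i * p j b * trace p = p j i * p a b := by
    intro i j a b
    rw [hent, htr i j]; ring
  by_contra hne
  have hprod : ∀ a i b, p a i * p a b = 0 := by
    intro a i b
    have := hkey i a a b
    have h' : p a i * p a b * (trace p - 1) = 0 := by linear_combination this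
    exact (mul_eq_zero.mp h').resolve_right (sub_ne_zero.mpr hne)
  apply h0
  ext a i
  simpa using hprod a i i

theorem jordan_map_anticomm {R : Type*} [Ring R] [Algebra K R] {φ : R →ₗ[K] R}
    (hφ : ∀ x, φ (x * x) = φ x * φ x) (x y : R) :
    φ (x * y + y * x) = φ x * φ y + φ y * φ x := by
  have h := hφ (x + y)
  simp only [mul_add, add_mul, map_add, hφ] at h ⊢
  rw [← sub_eq_zero] at h ⊢
  rw [← h]
  abel

theorem jordan_map_corner {R : Type*} [Ring R] [Algebra K R] (h2 : (2 : K) ≠ 0) {φ : R →ₗ[K] R}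
    (hφ : ∀ x, φ (x * x) = φ x * φ x) {e : R} (he : e * e = e) (x : R) :
    φ (e * x * e) = φ e * φ x * φ e := by
  have hp : φ e * φ e = φ e := by rw [← hφ, he]
  have h1 := jordan_map_anticomm hφ e x
  have h3 := jordan_map_anticomm hφ e (e * x + x * e)
  have e1 : e * (e * x + x * e) + (e * x + x * e) * e
      = (e * x + x * e) + (2 : K) • (e * x * e) := by
    rw [two_smul, mul_add, add_mul, ← mul_assoc, he, mul_assoc x, he, ← mul_assoc]; abel
  have e2 : φ e * (φ e * φ x + φ x * φ e) + (φ e * φ x + φ x * φ e) * φ e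
      = (φ e * φ x + φ x * φ e) + (2 : K) • (φ e * φ x * φ e) := by
    rw [two_smul, mul_add, add_mul, ← mul_assoc, hp, mul_assoc (φ x), hp, ← mul_assoc]; abel
  rw [e1, map_add, h1, e2, map_smul] at h3
  exact smul_right_injective _ h2 (add_left_cancel h3)

theorem trace_jordan_map_single (h2 : (2 : K) ≠ 0) {φ : Matrix n n K →ₗ[K] Matrix n n K}
    (hφ : ∀ x, φ (x * x) = φ x * φ x) (hbij : Function.Bijective φ) (i : n) :
    trace (φ (single i i 1)) = 1 := by
  have he : single i i (1 : K) * single i i 1 = single i i 1 := by simp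
  refine trace_eq_one_of_corner (by rw [← hφ, he]) ?_ fun x => ?_
  · intro h
    have h1 := hbij.1 (h.trans (map_zero φ).symm)
    have := congrFun (congrFun h1 i) i
    simp at this
  · obtain ⟨y, rfl⟩ := hbij.2 x
    refine ⟨y i i, ?_⟩
    rw [← jordan_map_corner h2 hφ he, ← map_smul]
    simp

theorem eq_smul_one_of_sq_eq_smul_one [IsAlgClosed K] [Nonempty n] {c : Matrix n n K} {κ : K}
    (hc : κ • (c * c) = 1) (hinj : ∀ w, c * w + w * c = 0 → w = 0) :
    ∃ s : K, c = s • 1 ∧ κ * s ^ 2 = 1 := by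
  have hκ : κ ≠ 0 := by
    rintro rfl
    simp at hc
  obtain ⟨s, hs⟩ := IsAlgClosed.exists_pow_nat_eq κ⁻¹ (n := 2) two_pos
  have hcc : c * c = s ^ 2 • 1 := by
    rw [hs, ← hc, smul_smul, inv_mul_cancel₀ hκ, one_smul]
  have hs1 : κ * s ^ 2 = 1 := by rw [hs, mul_inv_cancel₀ hκ]
  have key : ∀ w, (c - s • 1) * w * (c + s • 1) = 0 := by
    intro w
    have hl : c * (c - s • 1) = -s • (c - s • 1) := by
      rw [mul_sub, hcc, Matrix.mul_smul, mul_one, smul_sub, smul_smul, pow_two]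
      module
    have hr : (c + s • 1) * c = s • (c + s • 1) := by
      rw [add_mul, hcc, smul_mul, one_mul, smul_add, smul_smul, pow_two]
      module
    apply hinj
    rw [mul_assoc _ (c + s • 1) c, hr, ← mul_assoc, ← mul_assoc, hl, Matrix.mul_smul, smul_mul,
      smul_mul, neg_smul, neg_add_cancel]
  have hor : c - s • 1 = 0 ∨ c + s • 1 = 0 := by
    by_contra! h
    obtain ⟨h1, h3⟩ := h
    obtain ⟨a, b, hab⟩ : ∃ a b, (c - s • 1) a b ≠ 0 := by
      by_contra! h; exact h1 (by ext a b; exact h a b)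
    obtain ⟨d, e, hde⟩ : ∃ a b, (c + s • 1) a b ≠ 0 := by
      by_contra! h; exact h3 (by ext a b; exact h a b)
    have h4 := congrFun (congrFun (key (single b d 1)) a) e
    rw [mul_assoc, mul_apply, Finset.sum_eq_single b] at h4
    · simp only [single_mul_apply_same, one_mul, Matrix.zero_apply] at h4
      exact (mul_ne_zero hab hde) h4
    · intro k _ hk
      simp [hk]
    · simp
  rcases hor with h | h
  · exact ⟨s, sub_eq_zero.mp h, hs1⟩
  · exact ⟨-s, by rw [neg_smul]; exact eq_neg_of_add_eq_zero_left h, by rw [neg_sq, hs1]⟩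

/-- A linear map on matrices preserving the polarized cubic form
`trace (x * x * y)` preserves fourth powers. -/
theorem map_pow_four_of_trace_cubic [IsAlgClosed K] [Nonempty n] (h2 : (2 : K) ≠ 0)
    (θ : Matrix n n K →ₗ[K] Matrix n n K)
    (h : ∀ x y z, trace ((θ x * θ y + θ y * θ x) * θ z) = trace ((x * y + y * x) * z))
    (x : Matrix n n K) : θ (x ^ 4) = θ x ^ 4 := by
  have nondeg : ∀ a b : Matrix n n K, (∀ z, trace (a * θ z) = trace (b * θ z)) →
      Function.Surjective θ → a = b := fun a b hab hsurj =>
    ext_iff_trace_mul_right.mpr fun w => by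
      obtain ⟨z, rfl⟩ := hsurj w
      exact hab z
  have nondeg0 : ∀ a : Matrix n n K, (∀ z, trace (a * z) = 0) → a = 0 := fun a ha =>
    ext_iff_trace_mul_right.mpr fun w => by simp [ha]
  have hc : ∀ w, θ 1 * θ w + θ w * θ 1 = 0 → w = 0 := by
    intro w hw
    have h1 : (2 : K) • w = 0 := nondeg0 _ fun z => by
      have := h 1 w z
      rw [hw, zero_mul, trace_zero, one_mul, mul_one, ← two_smul K] at this
      exact this.symm
    exact (smul_eq_zero.mp h1).resolve_left h2
  have hinj : Function.Injective θ := by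
    rw [injective_iff_map_eq_zero]
    intro w hw
    exact hc w (by simp [hw])
  have hsurj : Function.Surjective θ := LinearMap.injective_iff_surjective.mp hinj
  have hsq : ∀ x y, trace (θ x * θ x * θ y) = trace (x * x * y) := by
    intro x y
    have := h x x y
    simp only [← two_smul K, smul_mul, trace_smul] at this
    exact smul_right_injective _ h2 this
  obtain ⟨κ, hκ⟩ := exists_eq_mul_trace_of_sq_zero (traceLinearMap n K K ∘ₗ θ) (by
    intro x hx
    have h1 : θ x * θ x = 0 := nondeg _ _ (fun z => by simp [hsq, hx]) hsurj
    have : IsNilpotent (θ x) := ⟨2, by rw [pow_two, h1]⟩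
    exact (isNilpotent_trace_of_isNilpotent this).eq_zero)
  simp only [LinearMap.comp_apply, traceLinearMap_apply] at hκ
  have hcc : κ • (θ 1 * θ 1) = 1 := nondeg _ _ (fun z => by
    rw [smul_mul, trace_smul, hsq, one_mul, one_mul, one_mul, hκ, smul_eq_mul]) hsurj
  obtain ⟨s, hs, hκs⟩ := eq_smul_one_of_sq_eq_smul_one hcc (by
    intro w hw
    obtain ⟨v, rfl⟩ := hsurj w
    rw [hc v hw, map_zero])
  have hs0 : s ≠ 0 := by
    rintro rfl
    simp at hκs
  have hθsq : ∀ x, θ x * θ x = s • θ (x * x) := fun x => nondeg _ _ (fun z => by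
    have := h 1 (x * x) z
    simp only [hs, smul_mul, Matrix.mul_smul, one_mul, mul_one, ← two_smul K, trace_smul] at this
    rw [hsq, smul_mul, trace_smul]
    exact (smul_right_injective _ h2 this).symm) hsurj
  obtain ⟨i⟩ := ‹Nonempty n›
  have hone := trace_jordan_map_single (φ := s⁻¹ • θ) h2 (by
    intro x
    simp only [LinearMap.smul_apply, smul_mul, Matrix.mul_smul, hθsq, smul_smul]
    rw [inv_mul_cancel₀ hs0, mul_one])
    ⟨fun a b hab => hinj (smul_right_injective _ (inv_ne_zero hs0) hab), fun w => by
      obtain ⟨v, hv⟩ := hsurj (s • w)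
      exact ⟨v, by rw [LinearMap.smul_apply, hv, smul_smul, inv_mul_cancel₀ hs0, one_smul]⟩⟩ i
  have hks : κ = s := by
    rw [LinearMap.smul_apply, trace_smul, hκ, trace_single_eq_same, smul_eq_mul, mul_one] at hone
    field_simp at hone
    exact hone
  have hs3 : s * s * s = 1 := by rw [hks] at hκs; linear_combination hκs
  have e4 : ∀ y : Matrix n n K, y ^ 4 = (y * y) * (y * y) := fun y => by noncomm_ring
  rw [e4, e4, hθsq x, smul_mul, Matrix.mul_smul, hθsq, smul_smul, smul_smul, hs3, one_smul]

end MatrixPreserver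

section BaseChange

open scoped TensorProduct

theorem TwoSidedIdeal.isSimpleRing_quotient {R : Type*} [Ring R] {M : TwoSidedIdeal R}
    (hM : IsCoatom M) : IsSimpleRing M.ringCon.Quotient := by
  have h1 : IsCoatom M.ringCon := TwoSidedIdeal.orderIsoRingCon.isCoatom_iff M |>.mpr hM
  have h2 : IsSimpleOrder (Set.Ici M.ringCon) := Set.isSimpleOrder_Ici_iff_isCoatom.mpr h1
  exact ⟨(TwoSidedIdeal.orderIsoRingCon.trans
    (RingCon.correspondence (c := M.ringCon)).symm).isSimpleOrder⟩

theorem exists_surjective_algHom_matrix (K B : Type*) [Field K] [IsAlgClosed K] [Ring B]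
    [Nontrivial B] [Algebra K B] [FiniteDimensional K B] :
    ∃ (n : ℕ) (_ : NeZero n) (π : B →ₐ[K] Matrix (Fin n) (Fin n) K), Function.Surjective π := by
  have : IsNoetherianRing B := isNoetherian_of_tower K inferInstance
  have hmono : StrictMono (TwoSidedIdeal.asIdeal (R := B)) :=
    TwoSidedIdeal.asIdeal.monotone.strictMono_of_injective fun I J h =>
      TwoSidedIdeal.ext fun x => by
        rw [← TwoSidedIdeal.mem_asIdeal, h, TwoSidedIdeal.mem_asIdeal]
  have : WellFoundedGT (TwoSidedIdeal B) := hmono.wellFoundedGT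
  obtain ⟨M, hM, -⟩ := (eq_top_or_exists_le_coatom (⊥ : TwoSidedIdeal B)).resolve_left bot_ne_top
  have := TwoSidedIdeal.isSimpleRing_quotient hM
  have hq : Function.Surjective (M.ringCon.mkₐ K) := RingCon.mk'_surjective _
  have : FiniteDimensional K M.ringCon.Quotient :=
    Module.Finite.of_surjective (M.ringCon.mkₐ K).toLinearMap hq
  obtain ⟨n, hn, ⟨e⟩⟩ := IsSimpleRing.exists_algEquiv_matrix_of_isAlgClosed K M.ringCon.Quotient
  exact ⟨n, hn, e.toAlgHom.comp (M.ringCon.mkₐ K), e.surjective.comp hq⟩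

theorem exists_algHom_matrix_of_isCoatom {F A : Type*} (K : Type*) [Field F] [Ring A] [Algebra F A]
    [FiniteDimensional F A] [Field K] [IsAlgClosed K] [Algebra F K] {M : TwoSidedIdeal A}
    (hM : IsCoatom M) :
    ∃ (n : ℕ) (_ : NeZero n) (ρ : A →ₐ[F] Matrix (Fin n) (Fin n) K),
      Function.Surjective (ρ.toLinearMap.liftBaseChange K) ∧ ∀ a, ρ a = 0 → a ∈ M := by
  have := TwoSidedIdeal.isSimpleRing_quotient hM
  have hq : Function.Surjective (M.ringCon.mkₐ F) := RingCon.mk'_surjective _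
  have : FiniteDimensional F M.ringCon.Quotient :=
    Module.Finite.of_surjective (M.ringCon.mkₐ F).toLinearMap hq
  obtain ⟨n, hn, π, hπ⟩ := exists_surjective_algHom_matrix K (K ⊗[F] M.ringCon.Quotient)
  let σ : M.ringCon.Quotient →ₐ[F] Matrix (Fin n) (Fin n) K :=
    (π.restrictScalars F).comp Algebra.TensorProduct.includeRight
  refine ⟨n, hn, σ.comp (M.ringCon.mkₐ F), ?_, fun a ha => ?_⟩
  · intro w
    obtain ⟨t, rfl⟩ := hπ w
    induction t with
    | zero => exact ⟨0, by simp⟩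
    | add x y hx hy =>
      obtain ⟨u, hu⟩ := hx
      obtain ⟨v, hv⟩ := hy
      exact ⟨u + v, by rw [map_add, map_add, hu, hv]⟩
    | tmul k b =>
      obtain ⟨a, rfl⟩ := hq b
      refine ⟨k ⊗ₜ a, ?_⟩
      simp only [LinearMap.liftBaseChange_tmul]
      have : k ⊗ₜ[F] (M.ringCon.mkₐ F) a = k • ((1 : K) ⊗ₜ[F] (M.ringCon.mkₐ F) a) := by
        simp [TensorProduct.smul_tmul']
      rw [this, map_smul]
      rfl
  · have h0 : (M.ringCon.mkₐ F) a = (M.ringCon.mkₐ F) 0 :=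
      σ.toRingHom.injective (ha.trans (by simp))
    exact (RingCon.eq _).mp h0

/-- Polarization of the invariance of the cubic form `t (x ^ 3)` of a trace functional `t`. -/
theorem trace_cubic_polarization {F A V : Type*} [Field F] [Ring A] [Algebra F A]
    [AddCommGroup V] [Module F V] (h2 : (2 : F) ≠ 0) (h3 : (3 : F) ≠ 0) {t : A →ₗ[F] V}
    (ht : ∀ x y, t (x * y) = t (y * x)) {T : A →ₗ[F] A} (hT : ∀ x, t (T x ^ 3) = t (x ^ 3))
    (x y z : A) :
    t ((T x * T y + T y * T x) * T z) = t ((x * y + y * x) * z) := by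
  have h6 : (6 : F) ≠ 0 := by
    rw [show (6 : F) = 2 * 3 by norm_num]; exact mul_ne_zero h2 h3
  have hcube : ∀ a b : A,
      t ((a + b) ^ 3) + t ((a - b) ^ 3) - (2 : F) • t (a ^ 3) = (6 : F) • t (b * b * a) := by
    intro a b
    have e : (a + b) ^ 3 + (a - b) ^ 3 - (2 : F) • a ^ 3
        = (2 : F) • (b * b * a + b * (a * b) + a * (b * b)) := by
      simp only [two_smul]
      noncomm_ring
    rw [← map_add, ← map_smul, ← map_sub, e, map_smul, map_add, map_add, ht b (a * b),
      mul_assoc a b b, ht a (b * b)]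
    module
  have hsq : ∀ a b : A, t (T b * T b * T a) = t (b * b * a) := by
    intro a b
    apply smul_right_injective V h6
    change (6 : F) • _ = (6 : F) • _
    rw [← hcube, ← hcube, ← map_add T, ← map_sub T, hT, hT, hT]
  have h := hsq z (x + y)
  simp only [map_add, mul_add, add_mul, hsq] at h ⊢
  rw [← sub_eq_zero] at h ⊢
  rw [← h]
  abel

theorem LinearMap.ker_eq_of_ker_le_of_surjective {K V W : Type*} [Field K] [AddCommGroup V]
    [Module K V] [FiniteDimensional K V] [AddCommGroup W] [Module K W] {f g : V →ₗ[K] W}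
    (hf : Function.Surjective f) (h : ker g ≤ ker f) : ker g = ker f := by
  have : FiniteDimensional K W := Module.Finite.of_surjective f hf
  refine Submodule.eq_of_le_of_finrank_le h ?_
  have h1 := f.finrank_range_add_finrank_ker
  have h2 := g.finrank_range_add_finrank_ker
  rw [LinearMap.range_eq_top.mpr hf, finrank_top] at h1
  have h3 := (LinearMap.range g).finrank_le
  omega

open Matrix in
theorem trace_cubic_liftBaseChange {F A K n : Type*} [Field F] [Ring A] [Algebra F A] [Field K]
    [Algebra F K] [Fintype n] [DecidableEq n] {ρ τ : A →ₗ[F] Matrix n n K}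
    (h : ∀ x y z, trace ((τ x * τ y + τ y * τ x) * τ z) = trace ((ρ x * ρ y + ρ y * ρ x) * ρ z))
    (x y z : K ⊗[F] A) :
    trace ((τ.liftBaseChange K x * τ.liftBaseChange K y
        + τ.liftBaseChange K y * τ.liftBaseChange K x) * τ.liftBaseChange K z)
      = trace ((ρ.liftBaseChange K x * ρ.liftBaseChange K y
        + ρ.liftBaseChange K y * ρ.liftBaseChange K x) * ρ.liftBaseChange K z) := by
  induction x with
  | zero => simp
  | add x₁ x₂ h₁ h₂ =>
    simp only [map_add, add_mul, mul_add, trace_add] at h₁ h₂ ⊢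
    linear_combination h₁ + h₂
  | tmul a x =>
    induction y with
    | zero => simp
    | add x₁ x₂ h₁ h₂ =>
      simp only [map_add, add_mul, mul_add, trace_add] at h₁ h₂ ⊢
      linear_combination h₁ + h₂
    | tmul b y =>
      induction z with
      | zero => simp
      | add x₁ x₂ h₁ h₂ =>
        simp only [map_add, add_mul, mul_add, trace_add] at h₁ h₂ ⊢
        linear_combination h₁ + h₂
      | tmul c z =>
        have := h x y z
        simp only [LinearMap.liftBaseChange_tmul, smul_mul, Matrix.mul_smul, trace_smul, add_mul,
          trace_add, smul_eq_mul] at this ⊢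
        linear_combination a * b * c * this

open Matrix in
theorem AlgHom.map_pow_four_of_trace_cubic {F A K n : Type*} [Field F] [Ring A] [Algebra F A]
    [FiniteDimensional F A] [Field K] [IsAlgClosed K] [Algebra F K] [Fintype n] [DecidableEq n]
    [Nonempty n] (h2 : (2 : K) ≠ 0) (ρ : A →ₐ[F] Matrix n n K)
    (hρ : Function.Surjective (ρ.toLinearMap.liftBaseChange K)) (T : A →ₗ[F] A)
    (h : ∀ x y z, trace (ρ ((T x * T y + T y * T x) * T z)) = trace (ρ ((x * y + y * x) * z)))
    (x : A) : ρ (T (x ^ 4)) = ρ (T x ^ 4) := by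
  set r := ρ.toLinearMap.liftBaseChange K with hr
  set s := (ρ.toLinearMap ∘ₗ T).liftBaseChange K with hs
  have hrs : ∀ u v w, trace ((s u * s v + s v * s u) * s w)
      = trace ((r u * r v + r v * r u) * r w) := fun u v w =>
    trace_cubic_liftBaseChange (fun x y z => by simpa using h x y z) u v w
  have hr1 : ∀ a, r (1 ⊗ₜ a) = ρ a := fun a => by simp [hr]
  have hs1 : ∀ a, s (1 ⊗ₜ a) = ρ (T a) := fun a => by simp [hs]
  have hker : LinearMap.ker s = LinearMap.ker r := by
    refine LinearMap.ker_eq_of_ker_le_of_surjective hρ fun u hu => ?_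
    rw [LinearMap.mem_ker] at hu ⊢
    have h0 : (2 : K) • r u = 0 := ext_iff_trace_mul_right.mpr fun w => by
      obtain ⟨v, rfl⟩ := hρ w
      have := hrs u (1 ⊗ₜ 1) v
      rw [hu, hr1, map_one, mul_one, one_mul, ← two_smul K] at this
      rw [← this]
      simp
    exact (smul_eq_zero.mp h0).resolve_left h2
  obtain ⟨σ, hσ⟩ := r.exists_rightInverse_of_surjective (LinearMap.range_eq_top.mpr hρ)
  have hrσ : ∀ w, r (σ w) = w := fun w => LinearMap.congr_fun hσ w
  have hθ : ∀ a, s (σ (ρ a)) = ρ (T a) := fun a => by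
    have : σ (ρ a) - 1 ⊗ₜ a ∈ LinearMap.ker s := by
      rw [hker, LinearMap.mem_ker, map_sub, hrσ, hr1, sub_self]
    rw [LinearMap.mem_ker, map_sub, sub_eq_zero, hs1] at this
    exact this
  have := _root_.map_pow_four_of_trace_cubic h2 (s ∘ₗ σ)
    (fun x y z => by simpa [hrσ] using hrs (σ x) (σ y) (σ z)) (ρ x)
  rw [← map_pow, LinearMap.comp_apply, LinearMap.comp_apply, hθ, hθ] at this
  rw [this, map_pow]

end BaseChange

/-- **Corollary 3.7 (first part).** Let `A` be a finite-dimensional algebra over a field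
`F` with `char F ≠ 2, 3`. If a linear map `T : A → A` satisfies `T x ^ 3 - x ^ 3 ∈ [A,A]`
for every `x ∈ A`, then `T (x ^ 4) - T x ^ 4 ∈ rad A` for every `x ∈ A`. -/
theorem fourth_power_diff_mem_radical (F A : Type*) [Field F] [Ring A] [Algebra F A]
    [FiniteDimensional F A] (h2 : (2 : F) ≠ 0) (h3 : (3 : F) ≠ 0) (T : A →ₗ[F] A)
    (hT : ∀ x : A, T x ^ 3 - x ^ 3 ∈
      Submodule.span F {z : A | ∃ u v : A, z = u * v - v * u}) :
    ∀ x : A, T (x ^ 4) - T x ^ 4 ∈ ringRad A := by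
  intro x
  let K := AlgebraicClosure F
  have h2K : (2 : K) ≠ 0 := by
    rw [← map_ofNat (algebraMap F K) 2]
    exact (map_ne_zero (algebraMap F K)).mpr h2
  rw [ringRad, TwoSidedIdeal.mem_sInf]
  intro M hM
  obtain ⟨n, hn, ρ, hρ, hρM⟩ := exists_algHom_matrix_of_isCoatom (F := F) K hM
  let t : A →ₗ[F] K := (Matrix.traceLinearMap (Fin n) F K) ∘ₗ ρ.toLinearMap
  have ht : ∀ u v, t (u * v) = t (v * u) := fun u v => by
    simpa [t] using Matrix.trace_mul_comm (ρ u) (ρ v)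
  have hspan : Submodule.span F {z : A | ∃ u v : A, z = u * v - v * u} ≤ LinearMap.ker t := by
    rw [Submodule.span_le]
    rintro _ ⟨u, v, rfl⟩
    simp [ht u v]
  have hcube : ∀ y, t (T y ^ 3) = t (y ^ 3) := fun y => by
    have := hspan (hT y)
    rwa [LinearMap.mem_ker, map_sub, sub_eq_zero] at this
  apply hρM
  rw [map_sub, sub_eq_zero]
  exact ρ.map_pow_four_of_trace_cubic h2K hρ T (trace_cubic_polarization h2 h3 ht hcube) x
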